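/- Let M be a feasible matching in a marriage instance with critical men, and suppose some level assignment satisfies the min-size conditions for M. Then M is a minimum size popular feasible matching. -/

import Mathlib

open Classical

universe u v

/-- A marriage instance with critical men: a finite bipartite graph with edge set `E ⊆ A × B`,
a set `C ⊆ A` of critical men, and strict preference orders of each vertex over its
neighbours (`prefA m w w'` : man `m` strictly prefers woman `w` to woman `w'`;
`prefB w m m'` : woman `w` strictly prefers man `m` to man `m'`). -/
structure CritInstance (A : Type u) (B : Type v) where
  E : Finset (A × B)
  C : Finset A
  prefA : A → B → B → Prop
  prefB : B → A → A → Prop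
  prefA_irrefl : ∀ m w, ¬ prefA m w w
  prefA_trans : ∀ m w₁ w₂ w₃, prefA m w₁ w₂ → prefA m w₂ w₃ → prefA m w₁ w₃
  prefA_total : ∀ m w₁ w₂, (m, w₁) ∈ E → (m, w₂) ∈ E → w₁ ≠ w₂ →
    prefA m w₁ w₂ ∨ prefA m w₂ w₁
  prefB_irrefl : ∀ w m, ¬ prefB w m m
  prefB_trans : ∀ w m₁ m₂ m₃, prefB w m₁ m₂ → prefB w m₂ m₃ → prefB w m₁ m₃
  prefB_total : ∀ w m₁ m₂, (m₁, w) ∈ E → (m₂, w) ∈ E → m₁ ≠ m₂ →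
    prefB w m₁ m₂ ∨ prefB w m₂ m₁

namespace CritInstance

variable {A : Type u} {B : Type v}

/-- `M` is a matching: a set of edges in which every vertex has at most one partner. -/
def IsMatching (I : CritInstance A B) (M : Finset (A × B)) : Prop :=
  M ⊆ I.E ∧ (∀ ⦃m w w'⦄, (m, w) ∈ M → (m, w') ∈ M → w = w') ∧
    (∀ ⦃m m' w⦄, (m, w) ∈ M → (m', w) ∈ M → m = m')

/-- Man `m` is matched in `M`. -/
def ManMatched (M : Finset (A × B)) (m : A) : Prop := ∃ w, (m, w) ∈ M

/-- Woman `w` is matched in `M`. -/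
def WomanMatched (M : Finset (A × B)) (w : B) : Prop := ∃ m, (m, w) ∈ M

/-- `M` is feasible: it is a matching and every critical man is matched. -/
def IsFeasible (I : CritInstance A B) (M : Finset (A × B)) : Prop :=
  IsMatching I M ∧ ∀ m ∈ I.C, ManMatched M m

/-- Man `m` prefers matching `M` to matching `N`: he is matched in `M` and either
unmatched in `N` or strictly prefers his `M`-partner to his `N`-partner. -/
def ManPrefers (I : CritInstance A B) (M N : Finset (A × B)) (m : A) : Prop :=
  ∃ w, (m, w) ∈ M ∧ (¬ ManMatched N m ∨ ∃ w', (m, w') ∈ N ∧ I.prefA m w w')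

/-- Woman `w` prefers matching `M` to matching `N`. -/
def WomanPrefers (I : CritInstance A B) (M N : Finset (A × B)) (w : B) : Prop :=
  ∃ m, (m, w) ∈ M ∧ (¬ WomanMatched N w ∨ ∃ m', (m', w) ∈ N ∧ I.prefB w m m')

/-- `phi I M N` is the number of vertices that prefer `M` to `N`. -/
noncomputable def phi [Fintype A] [Fintype B] (I : CritInstance A B)
    (M N : Finset (A × B)) : ℕ :=
  (Finset.univ.filter fun m : A => ManPrefers I M N m).card +
    (Finset.univ.filter fun w : B => WomanPrefers I M N w).card

/-- `M` is a popular feasible matching. -/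
def IsPFM [Fintype A] [Fintype B] (I : CritInstance A B) (M : Finset (A × B)) : Prop :=
  IsFeasible I M ∧ ∀ N, IsFeasible I N → phi I N M ≤ phi I M N

/-- `M` is a minimum size popular feasible matching. -/
def IsMinPFM [Fintype A] [Fintype B] (I : CritInstance A B) (M : Finset (A × B)) : Prop :=
  IsPFM I M ∧ ∀ N, IsPFM I N → M.card ≤ N.card

/-- `M` is a dominant feasible matching. -/
def IsDFM [Fintype A] [Fintype B] (I : CritInstance A B) (M : Finset (A × B)) : Prop :=
  IsPFM I M ∧ ∀ N, IsFeasible I N → M.card < N.card → phi I N M < phi I M N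

/-- `(m,w)` is a `(+1,+1)` edge with respect to `M`: an edge of `E ∖ M` such that `m` is
unmatched or prefers `w` to his partner, and `w` is unmatched or prefers `m` to her partner. -/
def PlusPlus (I : CritInstance A B) (M : Finset (A × B)) (m : A) (w : B) : Prop :=
  (m, w) ∈ I.E ∧ (m, w) ∉ M ∧
    (¬ ManMatched M m ∨ ∃ w', (m, w') ∈ M ∧ I.prefA m w w') ∧
    (¬ WomanMatched M w ∨ ∃ m', (m', w) ∈ M ∧ I.prefB w m m')

/-- `(m,w)` is a `(−1,−1)` edge with respect to `M`: an edge of `E ∖ M` such that `m` is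
matched and prefers his partner to `w`, and `w` is matched and prefers her partner to `m`. -/
def MinusMinus (I : CritInstance A B) (M : Finset (A × B)) (m : A) (w : B) : Prop :=
  (m, w) ∈ I.E ∧ (m, w) ∉ M ∧
    (∃ w', (m, w') ∈ M ∧ I.prefA m w' w) ∧
    (∃ m', (m', w) ∈ M ∧ I.prefB w m' m)

/-- `M` is a stable matching: a matching with no blocking pair. -/
def IsStable (I : CritInstance A B) (M : Finset (A × B)) : Prop :=
  IsMatching I M ∧ ∀ m w, ¬ PlusPlus I M m w

/-- The min-size conditions for a level assignment `(lA, lB)` with respect to `M`: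
(i) matched partners share a level, unmatched vertices have level 0, non-critical men
have level 0; (ii) every `(+1,+1)` edge goes from a man to a strictly higher level woman;
(iii) every edge from a man at level `i` to a woman at level `i − 1` is a `(−1,−1)` edge;
(iv) no edge goes from a man at level `i` to a woman at level `≤ i − 2`. -/
def MinSizeConds (I : CritInstance A B) (M : Finset (A × B))
    (lA : A → ℕ) (lB : B → ℕ) : Prop :=
  (∀ m w, (m, w) ∈ M → lA m = lB w) ∧
  (∀ m, ¬ ManMatched M m → lA m = 0) ∧
  (∀ w, ¬ WomanMatched M w → lB w = 0) ∧
  (∀ m, m ∉ I.C → lA m = 0) ∧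
  (∀ m w, PlusPlus I M m w → lA m < lB w) ∧
  (∀ m w, (m, w) ∈ I.E → lB w + 1 = lA m → MinusMinus I M m w) ∧
  (∀ m w, (m, w) ∈ I.E → ¬ (lB w + 2 ≤ lA m))

/-- The dominant conditions for a level assignment `(lA, lB)` with respect to `M`:
(i) matched partners share a level, unmatched women have level 0, unmatched men have
level 1, non-critical men have level at most 1; (ii)–(iv) as in the min-size conditions. -/
def DomConds (I : CritInstance A B) (M : Finset (A × B))
    (lA : A → ℕ) (lB : B → ℕ) : Prop :=
  (∀ m w, (m, w) ∈ M → lA m = lB w) ∧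
  (∀ m, ¬ ManMatched M m → lA m = 1) ∧
  (∀ w, ¬ WomanMatched M w → lB w = 0) ∧
  (∀ m, m ∉ I.C → lA m ≤ 1) ∧
  (∀ m w, PlusPlus I M m w → lA m < lB w) ∧
  (∀ m w, (m, w) ∈ I.E → lB w + 1 = lA m → MinusMinus I M m w) ∧
  (∀ m w, (m, w) ∈ I.E → ¬ (lB w + 2 ≤ lA m))

/-- Adjacency in the bipartite graph, on the vertex set `A ⊕ B`. -/
def Adj (I : CritInstance A B) : A ⊕ B → A ⊕ B → Prop
  | Sum.inl m, Sum.inr w => (m, w) ∈ I.E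
  | Sum.inr w, Sum.inl m => (m, w) ∈ I.E
  | _, _ => False

/-- The (directed) pair `(u, v)` of vertices spans an edge of the matching `M`. -/
def StepM (M : Finset (A × B)) : A ⊕ B → A ⊕ B → Prop
  | Sum.inl m, Sum.inr w => (m, w) ∈ M
  | Sum.inr w, Sum.inl m => (m, w) ∈ M
  | _, _ => False

/-- The pair `(u, v)` of vertices spans a `(+1,+1)` edge with respect to `M`. -/
def StepPP (I : CritInstance A B) (M : Finset (A × B)) : A ⊕ B → A ⊕ B → Prop
  | Sum.inl m, Sum.inr w => PlusPlus I M m w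
  | Sum.inr w, Sum.inl m => PlusPlus I M m w
  | _, _ => False

/-- The pair `(u, v)` of vertices spans a `(−1,−1)` edge with respect to `M`. -/
def StepMM (I : CritInstance A B) (M : Finset (A × B)) : A ⊕ B → A ⊕ B → Prop
  | Sum.inl m, Sum.inr w => MinusMinus I M m w
  | Sum.inr w, Sum.inl m => MinusMinus I M m w
  | _, _ => False

/-- A vertex of `A ⊕ B` is matched in `M`. -/
def VMatched (M : Finset (A × B)) : A ⊕ B → Prop
  | Sum.inl m => ManMatched M m
  | Sum.inr w => WomanMatched M w

/-- An `M`-alternating path in the graph: a sequence of distinct vertices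
`vert 0, …, vert len` (`len ≥ 1` edges), consecutive vertices adjacent, with
consecutive edges alternately inside and outside `M`. -/
structure AltPath (I : CritInstance A B) (M : Finset (A × B)) where
  len : ℕ
  len_pos : 0 < len
  vert : ℕ → A ⊕ B
  inj : ∀ i j, i ≤ len → j ≤ len → vert i = vert j → i = j
  adj : ∀ i, i < len → Adj I (vert i) (vert (i + 1))
  alternate : ∀ i, i + 1 < len →
    (StepM M (vert i) (vert (i + 1)) ↔ ¬ StepM M (vert (i + 1)) (vert (i + 2)))

namespace AltPath

variable {I : CritInstance A B} {M : Finset (A × B)}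

/-- The number of `(+1,+1)` edges of the path. -/
noncomputable def countPP (ρ : AltPath I M) : ℕ :=
  ((Finset.range ρ.len).filter fun i => StepPP I M (ρ.vert i) (ρ.vert (i + 1))).card

/-- The number of `(−1,−1)` edges of the path. -/
noncomputable def countMM (ρ : AltPath I M) : ℕ :=
  ((Finset.range ρ.len).filter fun i => StepMM I M (ρ.vert i) (ρ.vert (i + 1))).card

/-- The vertex `u` lies on the path. -/
def Mem (ρ : AltPath I M) (u : A ⊕ B) : Prop := ∃ i ≤ ρ.len, ρ.vert i = u

/-- The set of edges of the path, as a set of pairs in `A × B`. -/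
noncomputable def edges (ρ : AltPath I M) : Finset (A × B) :=
  I.E.filter fun e => ∃ i < ρ.len,
    (ρ.vert i = Sum.inl e.1 ∧ ρ.vert (i + 1) = Sum.inr e.2) ∨
    (ρ.vert i = Sum.inr e.2 ∧ ρ.vert (i + 1) = Sum.inl e.1)

end AltPath

/-- An `M`-alternating cycle: a closed sequence of vertices `vert 0, …, vert len = vert 0`
(distinct except for the return), consecutive vertices adjacent, with edges alternately
inside and outside `M`, including around the wrap. -/
structure AltCycle (I : CritInstance A B) (M : Finset (A × B)) where
  len : ℕ
  len_pos : 0 < len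
  vert : ℕ → A ⊕ B
  closed : vert len = vert 0
  inj : ∀ i j, i < len → j < len → vert i = vert j → i = j
  adj : ∀ i, i < len → Adj I (vert i) (vert (i + 1))
  alternate : ∀ i, i + 1 < len →
    (StepM M (vert i) (vert (i + 1)) ↔ ¬ StepM M (vert (i + 1)) (vert (i + 2)))
  alternate_wrap : StepM M (vert (len - 1)) (vert len) ↔ ¬ StepM M (vert 0) (vert 1)

namespace AltCycle

variable {I : CritInstance A B} {M : Finset (A × B)}

/-- The number of `(+1,+1)` edges of the cycle. -/
noncomputable def countPP (σ : AltCycle I M) : ℕ :=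
  ((Finset.range σ.len).filter fun i => StepPP I M (σ.vert i) (σ.vert (i + 1))).card

/-- The number of `(−1,−1)` edges of the cycle. -/
noncomputable def countMM (σ : AltCycle I M) : ℕ :=
  ((Finset.range σ.len).filter fun i => StepMM I M (σ.vert i) (σ.vert (i + 1))).card

end AltCycle

/-- A size-increasing alternating path (SIAP) for `M`: an `M`-alternating path whose two
endpoints are a man unmatched in `M` and a woman unmatched in `M`, and which has equally
many `(+1,+1)` and `(−1,−1)` edges. -/
def IsSIAP (I : CritInstance A B) (M : Finset (A × B)) (ρ : AltPath I M) : Prop :=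
  (((∃ m, ρ.vert 0 = Sum.inl m ∧ ¬ ManMatched M m) ∧
      (∃ w, ρ.vert ρ.len = Sum.inr w ∧ ¬ WomanMatched M w)) ∨
    ((∃ w, ρ.vert 0 = Sum.inr w ∧ ¬ WomanMatched M w) ∧
      (∃ m, ρ.vert ρ.len = Sum.inl m ∧ ¬ ManMatched M m))) ∧
  ρ.countPP = ρ.countMM

/-- A size-reducing alternating path (SRAP) for `M` with respect to the level assignment
`(lA, lB)`: an `M`-alternating path both of whose terminal edges lie in `M`, starting at a
woman matched in `M` at level 0, ending at a non-critical man at level 1, whose number of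
`(+1,+1)` edges is exactly one more than its number of `(−1,−1)` edges. -/
def IsSRAP (I : CritInstance A B) (M : Finset (A × B)) (lA : A → ℕ) (lB : B → ℕ)
    (ρ : AltPath I M) : Prop :=
  StepM M (ρ.vert 0) (ρ.vert 1) ∧
  StepM M (ρ.vert (ρ.len - 1)) (ρ.vert ρ.len) ∧
  (((∃ w, ρ.vert 0 = Sum.inr w ∧ WomanMatched M w ∧ lB w = 0) ∧
      (∃ m, ρ.vert ρ.len = Sum.inl m ∧ m ∉ I.C ∧ lA m = 1)) ∨
    ((∃ m, ρ.vert 0 = Sum.inl m ∧ m ∉ I.C ∧ lA m = 1) ∧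
      (∃ w, ρ.vert ρ.len = Sum.inr w ∧ WomanMatched M w ∧ lB w = 0))) ∧
  ρ.countPP = ρ.countMM + 1

end CritInstance

namespace CritInstance

variable {A : Type u} {B : Type v} {I : CritInstance A B} {M N : Finset (A × B)}

/-- The vote of man `m` for `N` against `M`: `1`, `-1` or `0`. -/
noncomputable def manVote (I : CritInstance A B) (N M : Finset (A × B)) (m : A) : ℤ :=
  (if I.ManPrefers N M m then 1 else 0) - (if I.ManPrefers M N m then 1 else 0)

/-- The vote of woman `w` for `N` against `M`: `1`, `-1` or `0`. -/
noncomputable def womanVote (I : CritInstance A B) (N M : Finset (A × B)) (w : B) : ℤ :=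
  (if I.WomanPrefers N M w then 1 else 0) - (if I.WomanPrefers M N w then 1 else 0)

lemma phi_sub_phi [Fintype A] [Fintype B] :
    (I.phi N M : ℤ) - I.phi M N = ∑ m, I.manVote N M m + ∑ w, I.womanVote N M w := by
  simp only [phi, manVote, womanVote, Finset.sum_sub_distrib, Finset.sum_boole]
  push_cast
  ring

lemma manVote_le_one (m : A) : I.manVote N M m ≤ 1 := by
  unfold manVote
  split_ifs <;> norm_num

lemma womanVote_le_one (w : B) : I.womanVote N M w ≤ 1 := by
  unfold womanVote
  split_ifs <;> norm_num

lemma manVote_of_not_manMatched {m : A} (hm : ¬ ManMatched N m) :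
    I.manVote N M m = if ManMatched M m then -1 else 0 := by
  have h₁ : ¬ I.ManPrefers N M m := fun ⟨w, hw, _⟩ => hm ⟨w, hw⟩
  have h₂ : I.ManPrefers M N m ↔ ManMatched M m :=
    ⟨fun ⟨w, hw, _⟩ => ⟨w, hw⟩, fun ⟨w, hw⟩ => ⟨w, hw, Or.inl hm⟩⟩
  simp only [manVote, h₁, h₂, if_false]
  split_ifs <;> norm_num

lemma womanVote_nonpos_of_not_womanMatched {w : B} (hw : ¬ WomanMatched N w) :
    I.womanVote N M w ≤ 0 := by
  have h : ¬ I.WomanPrefers N M w := fun ⟨m, hm, _⟩ => hw ⟨m, hm⟩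
  simp only [womanVote, h, if_false]
  split_ifs <;> norm_num

lemma manPrefers_iff (hN : I.IsMatching N) {m : A} {w : B} (h : (m, w) ∈ N) :
    I.ManPrefers N M m ↔ ¬ ManMatched M m ∨ ∃ w', (m, w') ∈ M ∧ I.prefA m w w' := by
  refine ⟨fun ⟨w', hw', h'⟩ => ?_, fun h' => ⟨w, h, h'⟩⟩
  rwa [hN.2.1 h hw']

lemma womanPrefers_iff (hN : I.IsMatching N) {m : A} {w : B} (h : (m, w) ∈ N) :
    I.WomanPrefers N M w ↔ ¬ WomanMatched M w ∨ ∃ m', (m', w) ∈ M ∧ I.prefB w m m' := by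
  refine ⟨fun ⟨m', hm', h'⟩ => ?_, fun h' => ⟨m, h, h'⟩⟩
  rwa [hN.2.2 h hm']

lemma manVote_of_mem_of_mem (hN : I.IsMatching N) (hM : I.IsMatching M) {m : A} {w w' : B}
    (h : (m, w) ∈ N) (h' : (m, w') ∈ M) :
    I.manVote N M m =
      (if I.prefA m w w' then 1 else 0) - (if I.prefA m w' w then 1 else 0) := by
  have key : ∀ {N M : Finset (A × B)} {w w' : B}, I.IsMatching N → I.IsMatching M →
      (m, w) ∈ N → (m, w') ∈ M → (I.ManPrefers N M m ↔ I.prefA m w w') := by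
    intro N M w w' hN hM h h'
    rw [manPrefers_iff hN h]
    refine ⟨?_, fun hp => Or.inr ⟨w', h', hp⟩⟩
    rintro (hu | ⟨w'', h'', hp⟩)
    · exact (hu ⟨w', h'⟩).elim
    · rwa [hM.2.1 h' h'']
  simp only [manVote, key hN hM h h', key hM hN h' h]

lemma womanVote_of_mem_of_mem (hN : I.IsMatching N) (hM : I.IsMatching M) {m m' : A} {w : B}
    (h : (m, w) ∈ N) (h' : (m', w) ∈ M) :
    I.womanVote N M w =
      (if I.prefB w m m' then 1 else 0) - (if I.prefB w m' m then 1 else 0) := by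
  have key : ∀ {N M : Finset (A × B)} {m m' : A}, I.IsMatching N → I.IsMatching M →
      (m, w) ∈ N → (m', w) ∈ M → (I.WomanPrefers N M w ↔ I.prefB w m m') := by
    intro N M m m' hN hM h h'
    rw [womanPrefers_iff hN h]
    refine ⟨?_, fun hp => Or.inr ⟨m', h', hp⟩⟩
    rintro (hu | ⟨m'', h'', hp⟩)
    · exact (hu ⟨m', h'⟩).elim
    · rwa [hM.2.2 h' h'']
  simp only [womanVote, key hN hM h h', key hM hN h' h]

lemma manVote_eq_neg_one (hN : I.IsMatching N) (hM : I.IsMatching M) {m : A} {w : B}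
    (h : (m, w) ∈ N) (hne : (m, w) ∉ M) (hp : ¬ I.ManPrefers N M m) :
    I.manVote N M m = -1 := by
  have hp' := hp
  rw [manPrefers_iff hN h, not_or, not_not] at hp'
  obtain ⟨⟨w', h'⟩, hall⟩ := hp'
  have h₁ : ¬ I.prefA m w w' := fun hw => hall ⟨w', h', hw⟩
  have hww : w ≠ w' := by
    rintro rfl
    exact hne h'
  have h₂ := (I.prefA_total m w w' (hN.1 h) (hM.1 h') hww).resolve_left h₁
  simp [manVote_of_mem_of_mem hN hM h h', h₁, h₂]

lemma womanVote_eq_neg_one (hN : I.IsMatching N) (hM : I.IsMatching M) {m : A} {w : B}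
    (h : (m, w) ∈ N) (hne : (m, w) ∉ M) (hp : ¬ I.WomanPrefers N M w) :
    I.womanVote N M w = -1 := by
  have hp' := hp
  rw [womanPrefers_iff hN h, not_or, not_not] at hp'
  obtain ⟨⟨m', h'⟩, hall⟩ := hp'
  have h₁ : ¬ I.prefB w m m' := fun hm => hall ⟨m', h', hm⟩
  have hmm : m ≠ m' := by
    rintro rfl
    exact hne h'
  have h₂ := (I.prefB_total w m m' (hN.1 h) (hM.1 h') hmm).resolve_left h₁
  simp [womanVote_of_mem_of_mem hN hM h h', h₁, h₂]

/-- The levels form a dual certificate: the votes along an edge are bounded by twice the level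
difference of its endpoints. -/
lemma MinSizeConds.vote_add_vote_le {lA : A → ℕ} {lB : B → ℕ} (h : I.MinSizeConds M lA lB)
    (hN : I.IsMatching N) (hM : I.IsMatching M) {m : A} {w : B} (hmw : (m, w) ∈ N) :
    I.manVote N M m + I.womanVote N M w ≤ 2 * (lB w : ℤ) - 2 * lA m := by
  obtain ⟨hEq, -, -, -, hPP, hMM, hFar⟩ := h
  by_cases hmem : (m, w) ∈ M
  · rw [manVote_of_mem_of_mem hN hM hmw hmem, womanVote_of_mem_of_mem hN hM hmw hmem,
      hEq m w hmem]
    simp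
  have hfar := hFar m w (hN.1 hmw)
  have hA := I.manVote_le_one (N := N) (M := M) m
  have hB := I.womanVote_le_one (N := N) (M := M) w
  rcases lt_trichotomy (lA m) (lB w) with hlt | heq | hgt
  · omega
  · by_cases hpA : I.ManPrefers N M m
    · by_cases hpB : I.WomanPrefers N M w
      · have := hPP m w ⟨hN.1 hmw, hmem, (manPrefers_iff hN hmw).1 hpA,
          (womanPrefers_iff hN hmw).1 hpB⟩
        omega
      · have := womanVote_eq_neg_one hN hM hmw hmem hpB
        omega
    · have := manVote_eq_neg_one hN hM hmw hmem hpA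
      omega
  · obtain ⟨-, -, ⟨w', hw', hpA⟩, m', hm', hpB⟩ := hMM m w (hN.1 hmw) (by omega)
    have hnA : ¬ I.prefA m w w' := fun hc =>
      I.prefA_irrefl _ _ (I.prefA_trans _ _ _ _ hpA hc)
    have hnB : ¬ I.prefB w m m' := fun hc =>
      I.prefB_irrefl _ _ (I.prefB_trans _ _ _ _ hpB hc)
    have hvA : I.manVote N M m = -1 := by
      simp [manVote_of_mem_of_mem hN hM hmw hw', hpA, hnA]
    have hvB : I.womanVote N M w = -1 := by
      simp [womanVote_of_mem_of_mem hN hM hmw hm', hpB, hnB]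
    omega

lemma IsMatching.injOn_fst (hM : I.IsMatching M) : Set.InjOn Prod.fst (M : Set (A × B)) := by
  rintro ⟨m, w⟩ h ⟨_, w'⟩ h' rfl
  rw [hM.2.1 h h']

lemma IsMatching.injOn_snd (hM : I.IsMatching M) : Set.InjOn Prod.snd (M : Set (A × B)) := by
  rintro ⟨m, w⟩ h ⟨m', _⟩ h' rfl
  rw [hM.2.2 h h']

lemma IsMatching.sum_men [Fintype A] (hM : I.IsMatching M) (f : A → ℤ) :
    ∑ m, f m = ∑ e ∈ M, f e.1 + ∑ m with ¬ ManMatched M m, f m := by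
  rw [← Finset.sum_image (f := f) hM.injOn_fst,
    ← Finset.sum_filter_add_sum_filter_not Finset.univ (ManMatched M)]
  congr 2
  ext m
  rw [Finset.mem_filter]
  simp [ManMatched]

lemma IsMatching.sum_women [Fintype B] (hM : I.IsMatching M) (f : B → ℤ) :
    ∑ w, f w = ∑ e ∈ M, f e.2 + ∑ w with ¬ WomanMatched M w, f w := by
  rw [← Finset.sum_image (f := f) hM.injOn_snd,
    ← Finset.sum_filter_add_sum_filter_not Finset.univ (WomanMatched M)]
  congr 2
  ext w
  rw [Finset.mem_filter]
  simp [WomanMatched]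

lemma MinSizeConds.sum_level_eq [Fintype A] [Fintype B] {lA : A → ℕ} {lB : B → ℕ}
    (h : I.MinSizeConds M lA lB) (hM : I.IsMatching M) :
    ∑ m, (lA m : ℤ) = ∑ w, (lB w : ℤ) := by
  obtain ⟨hEq, hA, hB, -⟩ := h
  rw [hM.sum_men, hM.sum_women,
    Finset.sum_eq_zero (s := {m | ¬ ManMatched M m}) fun m hm => by
      simpa using hA m (by simpa using hm),
    Finset.sum_eq_zero (s := {w | ¬ WomanMatched M w}) fun w hw => by
      simpa using hB w (by simpa using hw),
    Finset.sum_congr rfl fun e he => by rw [hEq e.1 e.2 he]]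

/-- Each man matched in `M` but not in the feasible matching `N` contributes to the margin by
which `M` wins against `N`. -/
lemma MinSizeConds.phi_sub_phi_le [Fintype A] [Fintype B] {lA : A → ℕ} {lB : B → ℕ}
    (h : I.MinSizeConds M lA lB) (hM : I.IsMatching M) (hN : I.IsFeasible N) :
    (I.phi N M : ℤ) - I.phi M N ≤
      -(Finset.univ.filter fun m : A => ¬ ManMatched N m ∧ ManMatched M m).card := by
  have hsum : (I.phi N M : ℤ) - I.phi M N =
      ∑ m, (I.manVote N M m + 2 * lA m) + ∑ w, (I.womanVote N M w - 2 * lB w) := by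
    rw [phi_sub_phi, Finset.sum_add_distrib, Finset.sum_sub_distrib, ← Finset.mul_sum,
      ← Finset.mul_sum, h.sum_level_eq hM]
    ring
  have hedges : ∑ e ∈ N, (I.manVote N M e.1 + 2 * lA e.1) +
      ∑ e ∈ N, (I.womanVote N M e.2 - 2 * lB e.2) ≤ 0 := by
    rw [← Finset.sum_add_distrib]
    refine Finset.sum_nonpos fun e he => ?_
    have := h.vote_add_vote_le hN.1 hM (m := e.1) (w := e.2) he
    linarith
  have hmen : ∑ m with ¬ ManMatched N m, (I.manVote N M m + 2 * (lA m : ℤ)) =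
      -(Finset.univ.filter fun m : A => ¬ ManMatched N m ∧ ManMatched M m).card := by
    rw [← Finset.filter_filter, ← Finset.sum_boole, ← Finset.sum_neg_distrib]
    refine Finset.sum_congr rfl fun m hm => ?_
    have hm : ¬ ManMatched N m := by simpa using hm
    rw [manVote_of_not_manMatched hm, h.2.2.2.1 m fun hc => hm (hN.2 m hc)]
    split_ifs <;> simp
  have hwomen : ∑ w with ¬ WomanMatched N w, (I.womanVote N M w - 2 * (lB w : ℤ)) ≤ 0 := by
    refine Finset.sum_nonpos fun w hw => ?_
    have := womanVote_nonpos_of_not_womanMatched (I := I) (M := M) (by simpa using hw)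
    omega
  rw [hsum, hN.1.sum_men, hN.1.sum_women, hmen]
  linarith

lemma IsMatching.card_le_card (hM : I.IsMatching M) (h : ∀ m, ManMatched M m → ManMatched N m) :
    M.card ≤ N.card := by
  rw [← Finset.card_image_of_injOn hM.injOn_fst]
  refine (Finset.card_le_card ?_).trans (Finset.card_image_le (s := N) (f := Prod.fst))
  intro m hm
  obtain ⟨e, he, rfl⟩ := Finset.mem_image.1 hm
  obtain ⟨w, hw⟩ := h e.1 ⟨e.2, he⟩
  exact Finset.mem_image.2 ⟨_, hw, rfl⟩

end CritInstance

/-- If `M` is a feasible matching and some level assignment satisfies the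
min-size conditions for `M`, then `M` is a minimum size popular feasible matching. -/
theorem minSizeConds_isMinPFM {A : Type u} {B : Type v} [Fintype A] [Fintype B]
    (I : CritInstance A B) (M : Finset (A × B)) (hM : I.IsFeasible M)
    (lA : A → ℕ) (lB : B → ℕ) (h : I.MinSizeConds M lA lB) :
    I.IsMinPFM M := by
  refine ⟨⟨hM, fun N hN => ?_⟩, fun N hN => hM.1.card_le_card fun m hm => ?_⟩
  · have := h.phi_sub_phi_le hM.1 hN
    omega
  · have hle := h.phi_sub_phi_le hM.1 hN.1
    have hpop := hN.2 M hM
    by_contra hmN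
    have hpos : 0 < (Finset.univ.filter fun m : A =>
        ¬ CritInstance.ManMatched N m ∧ CritInstance.ManMatched M m).card :=
      Finset.card_pos.2 ⟨m, by simp [hmN, hm]⟩
    omega
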